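/- Let α = gcd(α_x, α_y, α_z), β_p = α_p/α, with β_y odd. Then the code distance d of the Chamon model with linear dimensions α_x, α_y, α_z satisfies d ≤ min{2β_yβ_zα, 2β_yβ_xα}. -/

import Mathlib

namespace Chamon

/-- Ambient group `A = ZMod (2αx) × ZMod (2αy) × ZMod (2αz)`. -/
abbrev Amb (ax ay az : ℕ) : Type :=
  ZMod (2 * ax) × ZMod (2 * ay) × ZMod (2 * az)

/-- Reduction mod 2 of a coordinate. -/
def par {n : ℕ} (a : ZMod (2 * n)) : ZMod 2 :=
  ZMod.castHom (dvd_mul_right 2 n) (ZMod 2) a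

variable (ax ay az : ℕ)

def ex : Amb ax ay az := (1, 0, 0)
def ey : Amb ax ay az := (0, 1, 0)
def ez : Amb ax ay az := (0, 0, 1)

/-- The data-qubit set `D`. -/
def dataSet : Set (Amb ax ay az) :=
  {a | par a.1 + par a.2.1 + par a.2.2 = 0}

/-- A Pauli operator (modulo phase): a pair of functions `D → ZMod 2`. -/
abbrev Pauli : Type :=
  (↥(dataSet ax ay az) → ZMod 2) × (↥(dataSet ax ay az) → ZMod 2)

/-- The stabilizer generator `S_s`. -/
def stab (s : Amb ax ay az) : Pauli ax ay az :=
  (fun d =>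
      (if (d : Amb ax ay az) = s + ex ax ay az then 1 else 0) +
      (if (d : Amb ax ay az) = s - ex ax ay az then 1 else 0) +
      (if (d : Amb ax ay az) = s + ey ax ay az then 1 else 0) +
      (if (d : Amb ax ay az) = s - ey ax ay az then 1 else 0),
   fun d =>
      (if (d : Amb ax ay az) = s + ez ax ay az then 1 else 0) +
      (if (d : Amb ax ay az) = s - ez ax ay az then 1 else 0) +
      (if (d : Amb ax ay az) = s + ey ax ay az then 1 else 0) +
      (if (d : Amb ax ay az) = s - ey ax ay az then 1 else 0))

/-- The symplectic form `ω(P,Q)`. -/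
noncomputable def sympl (P Q : Pauli ax ay az) : ZMod 2 :=
  ∑ᶠ d : ↥(dataSet ax ay az), (P.1 d * Q.2 d + P.2 d * Q.1 d)

/-- `X|_E`: X-part is the indicator of `E`, Z-part is zero. -/
noncomputable def Xop (E : Set (Amb ax ay az)) : Pauli ax ay az :=
  (fun d => E.indicator (fun _ => (1 : ZMod 2)) (d : Amb ax ay az), fun _ => 0)

/-- `Z|_E`: Z-part is the indicator of `E`, X-part is zero. -/
noncomputable def Zop (E : Set (Amb ax ay az)) : Pauli ax ay az :=
  (fun _ => 0, fun d => E.indicator (fun _ => (1 : ZMod 2)) (d : Amb ax ay az))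

/-- The `ZMod 2`-linear span `𝒮` of the stabilizer generators. -/
def stabSpan : Submodule (ZMod 2) (Pauli ax ay az) :=
  Submodule.span (ZMod 2) (stab ax ay az '' (dataSet ax ay az)ᶜ)

/-- The four generating points `g₀, g₁, g₂, g₃`. -/
def gpt : Fin 4 → Amb ax ay az := ![(0,0,0), (1,1,0), (1,0,1), (0,1,1)]

/-- Half-plane support `D_x^g` (parallel to the `yOz` plane). -/
def Dxg (g : Amb ax ay az) : Set (Amb ax ay az) :=
  {d | ∃ l m : ℤ, d = g + (2*l) • ez ax ay az + (2*m) • ey ax ay az}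

/-- Half-plane support `D_z^g` (parallel to the `xOy` plane). -/
def Dzg (g : Amb ax ay az) : Set (Amb ax ay az) :=
  {d | ∃ l m : ℤ, d = g + (2*l) • ex ax ay az + (2*m) • ey ax ay az}

end Chamon


namespace Chamon

variable (ax ay az : ℕ)

/-- A logical operator: a Pauli operator commuting with every stabilizer
generator and not lying in the stabilizer span `𝒮`. -/
def IsLogical (P : Pauli ax ay az) : Prop :=
  (∀ s ∉ dataSet ax ay az, sympl ax ay az (stab ax ay az s) P = 0) ∧
  P ∉ stabSpan ax ay az

/-- The weight of a Pauli operator: the number of data qubits on which it acts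
nontrivially. -/
noncomputable def wt (P : Pauli ax ay az) : ℕ :=
  {d : ↥(dataSet ax ay az) | ¬ (P.1 d = 0 ∧ P.2 d = 0)}.ncard

/-- The code distance: the minimum weight of a logical operator. -/
noncomputable def codeDistance : ℕ :=
  sInf {n | ∃ P : Pauli ax ay az, IsLogical ax ay az P ∧ wt ax ay az P = n}

end Chamon

namespace Chamon

variable {ax ay az : ℕ}

lemma par_natCast {n : ℕ} (t : ℕ) : par (t : ZMod (2 * n)) = t :=
  map_natCast (ZMod.castHom (dvd_mul_right 2 n) (ZMod 2)) t

lemma par_zero {n : ℕ} : par (0 : ZMod (2 * n)) = 0 :=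
  map_zero (ZMod.castHom (dvd_mul_right 2 n) (ZMod 2))

lemma par_add_one {n : ℕ} (a : ZMod (2 * n)) : par (a + 1) = par a + 1 := by
  simp [par]

lemma par_sub_one {n : ℕ} (a : ZMod (2 * n)) : par (a - 1) = par a + 1 := by
  simp [par, CharTwo.sub_eq_add]

/-- The neighbours of a stabilizer site are data qubits. -/
lemma neighbours_mem {s : Amb ax ay az} (hs : s ∉ dataSet ax ay az) :
    s + ex ax ay az ∈ dataSet ax ay az ∧ s - ex ax ay az ∈ dataSet ax ay az ∧
    s + ey ax ay az ∈ dataSet ax ay az ∧ s - ey ax ay az ∈ dataSet ax ay az ∧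
    s + ez ax ay az ∈ dataSet ax ay az ∧ s - ez ax ay az ∈ dataSet ax ay az := by
  simp only [dataSet, Set.mem_ofPred_eq, ex, ey, ez, Prod.fst_add, Prod.snd_add, Prod.fst_sub,
    Prod.snd_sub, add_zero, sub_zero, par_add_one, par_sub_one] at hs ⊢
  generalize par s.1 = a, par s.2.1 = b, par s.2.2 = c at hs ⊢
  revert a b c
  decide

lemma sum_ite_coe_mul [Fintype (dataSet ax ay az)] {a : Amb ax ay az}
    (ha : a ∈ dataSet ax ay az) (f : Amb ax ay az → ZMod 2) :
    ∑ d : dataSet ax ay az, (if (d : Amb ax ay az) = a then 1 else 0) * f d = f a := by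
  rw [Finset.sum_eq_single ⟨a, ha⟩]
  · simp
  · intro b _ hb
    rw [if_neg (fun h => hb (Subtype.ext h)), zero_mul]
  · simp

lemma sum_range_succ_eq_of_periodic {M : Type*} [AddCommMonoid M] (f : ℕ → M) {N : ℕ}
    (h : f N = f 0) : ∑ t ∈ Finset.range N, f (t + 1) = ∑ t ∈ Finset.range N, f t := by
  cases N with
  | zero => simp
  | succ n => rw [Finset.sum_range_succ, Finset.sum_range_succ' f, h]

lemma sum_range_mul_ite_natCast_eq_zero (m b : ℕ) [NeZero m] :
    ∑ t ∈ Finset.range (m * b), (if (t : ZMod m) = 0 then 1 else 0 : ZMod 2) = b := by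
  induction b with
  | zero => simp
  | succ b ih =>
    rw [mul_add_one, Finset.sum_range_add, ih, Finset.sum_eq_single 0]
    · simp
    · intro x hx hx0
      rw [Finset.mem_range] at hx
      rw [if_neg]
      simp only [Nat.cast_add, Nat.cast_mul, CharP.cast_eq_zero, zero_mul, zero_add,
        ZMod.natCast_eq_zero_iff]
      exact fun h => hx0 (Nat.eq_zero_of_dvd_of_lt h hx)
    · simp [Nat.pos_of_ne_zero (NeZero.ne m)]

/-- Multiplicity mod 2 of a point in the first `N` terms of a sequence. -/
def mult (p : ℕ → Amb ax ay az) (N : ℕ) (a : Amb ax ay az) : ZMod 2 :=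
  ∑ t ∈ Finset.range N, if a = p t then 1 else 0

lemma mult_add {p : ℕ → Amb ax ay az} {N : ℕ} {v : Amb ax ay az}
    (hp : ∀ t, p (t + 1) = p t + v) (hN : p N = p 0) (a : Amb ax ay az) :
    mult p N (a + v) = mult p N a := by
  rw [mult, ← sum_range_succ_eq_of_periodic _ (by rw [hN])]
  simp only [hp, add_left_inj, mult]

lemma exists_of_mult_ne_zero {p : ℕ → Amb ax ay az} {N : ℕ} {a : Amb ax ay az}
    (h : mult p N a ≠ 0) : ∃ t < N, a = p t := by
  obtain ⟨t, ht, h⟩ := Finset.exists_ne_zero_of_sum_ne_zero h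
  exact ⟨t, Finset.mem_range.1 ht, by simpa using h⟩

lemma wt_le {P : Pauli ax ay az} {p : ℕ → Amb ax ay az} {N : ℕ}
    (h : ∀ d, ¬ (P.1 d = 0 ∧ P.2 d = 0) → ∃ t < N, (d : Amb ax ay az) = p t) :
    wt ax ay az P ≤ N := by
  rw [wt, ← Set.ncard_image_of_injective _ Subtype.val_injective]
  calc _ ≤ ((Finset.range N).image p : Set (Amb ax ay az)).ncard := by
        refine Set.ncard_le_ncard ?_ (Finset.finite_toSet _)
        rintro _ ⟨d, hd, rfl⟩
        obtain ⟨t, ht, e⟩ := h d hd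
        rw [e]
        exact Finset.mem_coe.2 (Finset.mem_image_of_mem p (Finset.mem_range.2 ht))
    _ ≤ N := by
        rw [Set.ncard_coe_finset]
        exact Finset.card_image_le.trans_eq (Finset.card_range N)

section Finite

variable [NeZero ax] [NeZero ay] [NeZero az]

noncomputable instance : Fintype (dataSet ax ay az) := Fintype.ofFinite _

lemma sympl_eq_sum (P Q : Pauli ax ay az) :
    sympl ax ay az P Q = ∑ d, (P.1 d * Q.2 d + P.2 d * Q.1 d) :=
  finsum_eq_sum_of_fintype _

/-- The symplectic form with fixed second argument, as a linear functional. -/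
noncomputable def symplRight (Q : Pauli ax ay az) : Pauli ax ay az →ₗ[ZMod 2] ZMod 2 where
  toFun P := sympl ax ay az P Q
  map_add' P P' := by
    simp only [sympl_eq_sum, ← Finset.sum_add_distrib]
    exact Finset.sum_congr rfl fun d _ => by simp; ring
  map_smul' c P := by
    simp only [sympl_eq_sum, Finset.smul_sum]
    exact Finset.sum_congr rfl fun d _ => by simp; ring

/-- A Pauli operator commuting with the stabilizer is logical as soon as it anticommutes with
some other such operator. -/
lemma isLogical_of_sympl_ne_zero {P W : Pauli ax ay az}
    (hP : ∀ s ∉ dataSet ax ay az, sympl ax ay az (stab ax ay az s) P = 0)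
    (hW : ∀ s ∉ dataSet ax ay az, sympl ax ay az (stab ax ay az s) W = 0)
    (h : sympl ax ay az P W ≠ 0) : IsLogical ax ay az P := by
  refine ⟨hP, fun hmem => h ?_⟩
  have hle : stabSpan ax ay az ≤ LinearMap.ker (symplRight W) := by
    rw [stabSpan, Submodule.span_le]
    rintro _ ⟨s, hs, rfl⟩
    exact hW s hs
  exact hle hmem

lemma sum_mult_mul {p : ℕ → Amb ax ay az} (hp : ∀ t, p t ∈ dataSet ax ay az) (N : ℕ)
    (f : Amb ax ay az → ZMod 2) :
    ∑ d : dataSet ax ay az, mult p N d * f d = ∑ t ∈ Finset.range N, f (p t) := by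
  simp only [mult, Finset.sum_mul]
  rw [Finset.sum_comm]
  exact Finset.sum_congr rfl fun t _ => sum_ite_coe_mul (hp t) f

/-- The Pauli operator of `X` type with multiplicities `f`. -/
def ofX (f : Amb ax ay az → ZMod 2) : Pauli ax ay az := (fun d => f d, fun _ => 0)

/-- The Pauli operator of `Z` type with multiplicities `f`. -/
def ofZ (f : Amb ax ay az → ZMod 2) : Pauli ax ay az := (fun _ => 0, fun d => f d)

lemma sympl_stab_ofX {s : Amb ax ay az} (hs : s ∉ dataSet ax ay az)
    (f : Amb ax ay az → ZMod 2) :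
    sympl ax ay az (stab ax ay az s) (ofX f) =
      f (s + ez ax ay az) + f (s - ez ax ay az) + f (s + ey ax ay az) + f (s - ey ax ay az) := by
  obtain ⟨-, -, h₁, h₂, h₃, h₄⟩ := neighbours_mem hs
  simp only [sympl_eq_sum, ofX, stab, mul_zero, zero_add, add_mul, Finset.sum_add_distrib,
    sum_ite_coe_mul, h₁, h₂, h₃, h₄]

lemma sympl_stab_ofZ {s : Amb ax ay az} (hs : s ∉ dataSet ax ay az)
    (f : Amb ax ay az → ZMod 2) :
    sympl ax ay az (stab ax ay az s) (ofZ f) =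
      f (s + ex ax ay az) + f (s - ex ax ay az) + f (s + ey ax ay az) + f (s - ey ax ay az) := by
  obtain ⟨h₁, h₂, h₃, h₄, -, -⟩ := neighbours_mem hs
  simp only [sympl_eq_sum, ofZ, stab, mul_zero, add_zero, add_mul, Finset.sum_add_distrib,
    sum_ite_coe_mul, h₁, h₂, h₃, h₄]

/-- Indicator of the points of the plane `x = 0` with even `z`. -/
def planeX (a : Amb ax ay az) : ZMod 2 := if a.1 = 0 ∧ par a.2.2 = 0 then 1 else 0

/-- Indicator of the points of the plane `z = 0` with even `x`. -/
def planeZ (a : Amb ax ay az) : ZMod 2 := if a.2.2 = 0 ∧ par a.1 = 0 then 1 else 0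

lemma sympl_stab_planeX {s : Amb ax ay az} (hs : s ∉ dataSet ax ay az) :
    sympl ax ay az (stab ax ay az s) (ofX planeX) = 0 := by
  rw [sympl_stab_ofX hs]
  simp [planeX, ey, ez, par_add_one, par_sub_one, CharTwo.add_self_eq_zero]

lemma sympl_stab_planeZ {s : Amb ax ay az} (hs : s ∉ dataSet ax ay az) :
    sympl ax ay az (stab ax ay az s) (ofZ planeZ) = 0 := by
  rw [sympl_stab_ofZ hs]
  simp [planeZ, ex, ey, par_add_one, par_sub_one, CharTwo.add_self_eq_zero]

/-- An odd number of windings of the diagonal in a `yOz` plane is a logical operator. -/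
lemma codeDistance_le_of_diagonal_yz {b N : ℕ} (hb : Odd b) (hN : N = 2 * az * b)
    (hdvd : 2 * ay ∣ N) : codeDistance ax ay az ≤ N := by
  set p : ℕ → Amb ax ay az := fun t => (0, (t : ZMod (2 * ay)), (t : ZMod (2 * az))) with hp
  have hmem (t : ℕ) : p t ∈ dataSet ax ay az := by
    simp [hp, dataSet, par_natCast, par_zero, CharTwo.add_self_eq_zero]
  have hsucc (t : ℕ) : p (t + 1) = p t + (ey ax ay az + ez ax ay az) := by
    simp [hp, ey, ez]
  have hper : p N = p 0 := by
    simp [hp, (ZMod.natCast_eq_zero_iff N (2 * ay)).2 hdvd,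
      (ZMod.natCast_eq_zero_iff N (2 * az)).2 ⟨b, hN⟩]
  have hlog : IsLogical ax ay az (ofX (mult p N)) := by
    refine isLogical_of_sympl_ne_zero (fun s hs => ?_) (fun s hs => sympl_stab_planeZ hs) ?_
    · rw [sympl_stab_ofX hs, ← mult_add hsucc hper (s - ez ax ay az),
        ← mult_add hsucc hper (s - ey ax ay az),
        show s - ez ax ay az + (ey ax ay az + ez ax ay az) = s + ey ax ay az by abel,
        show s - ey ax ay az + (ey ax ay az + ez ax ay az) = s + ez ax ay az by abel,
        add_assoc, add_comm (mult p N (s + ey ax ay az)), CharTwo.add_self_eq_zero]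
    · simp only [sympl_eq_sum, ofX, ofZ, zero_mul, add_zero, sum_mult_mul hmem]
      simp only [planeZ, hp, par_zero, and_true]
      rw [hN, sum_range_mul_ite_natCast_eq_zero, hb.natCast_zmod_two]
      decide
  have hle : codeDistance ax ay az ≤ _ := Nat.sInf_le ⟨_, hlog, rfl⟩
  refine hle.trans (wt_le (p := p) fun d hd => exists_of_mult_ne_zero ?_)
  simpa [ofX] using hd

/-- An odd number of windings of the diagonal in an `xOy` plane is a logical operator. -/
lemma codeDistance_le_of_diagonal_xy {b N : ℕ} (hb : Odd b) (hN : N = 2 * ax * b)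
    (hdvd : 2 * ay ∣ N) : codeDistance ax ay az ≤ N := by
  set p : ℕ → Amb ax ay az := fun t => ((t : ZMod (2 * ax)), (t : ZMod (2 * ay)), 0) with hp
  have hmem (t : ℕ) : p t ∈ dataSet ax ay az := by
    simp [hp, dataSet, par_natCast, par_zero, CharTwo.add_self_eq_zero]
  have hsucc (t : ℕ) : p (t + 1) = p t + (ex ax ay az + ey ax ay az) := by
    simp [hp, ex, ey]
  have hper : p N = p 0 := by
    simp [hp, (ZMod.natCast_eq_zero_iff N (2 * ay)).2 hdvd,
      (ZMod.natCast_eq_zero_iff N (2 * ax)).2 ⟨b, hN⟩]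
  have hlog : IsLogical ax ay az (ofZ (mult p N)) := by
    refine isLogical_of_sympl_ne_zero (fun s hs => ?_) (fun s hs => sympl_stab_planeX hs) ?_
    · rw [sympl_stab_ofZ hs, ← mult_add hsucc hper (s - ex ax ay az),
        ← mult_add hsucc hper (s - ey ax ay az),
        show s - ex ax ay az + (ex ax ay az + ey ax ay az) = s + ey ax ay az by abel,
        show s - ey ax ay az + (ex ax ay az + ey ax ay az) = s + ex ax ay az by abel,
        add_assoc, add_comm (mult p N (s + ey ax ay az)), CharTwo.add_self_eq_zero]
    · simp only [sympl_eq_sum, ofX, ofZ, zero_mul, zero_add, sum_mult_mul hmem]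
      simp only [planeX, hp, par_zero, and_true]
      rw [hN, sum_range_mul_ite_natCast_eq_zero, hb.natCast_zmod_two]
      decide
  have hle : codeDistance ax ay az ≤ _ := Nat.sInf_le ⟨_, hlog, rfl⟩
  refine hle.trans (wt_le (p := p) fun d hd => exists_of_mult_ne_zero ?_)
  simpa [ofZ] using hd

end Finite

end Chamon

open Chamon

/-- with `α = gcd(αx,αy,αz)`, `βp = αp/α` and `βy` odd, the code
distance satisfies `d ≤ min{2βyβzα, 2βyβxα}`. -/
theorem chamon_code_distance_upper_bound (ax ay az α βx βy βz : ℕ)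
    (hax : 2 ≤ ax) (hay : 2 ≤ ay) (haz : 2 ≤ az)
    (hα : α = Nat.gcd (Nat.gcd ax ay) az)
    (hβx : ax = βx * α) (hβy : ay = βy * α) (hβz : az = βz * α)
    (hodd : Odd βy) :
    codeDistance ax ay az ≤ min (2 * βy * βz * α) (2 * βy * βx * α) := by
  have : NeZero ax := ⟨by lia⟩
  have : NeZero ay := ⟨by lia⟩
  have : NeZero az := ⟨by lia⟩
  refine le_min (codeDistance_le_of_diagonal_yz hodd ?_ ⟨βz, ?_⟩)
    (codeDistance_le_of_diagonal_xy hodd ?_ ⟨βx, ?_⟩)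
  · rw [hβz]; ring
  · rw [hβy]; ring
  · rw [hβx]; ring
  · rw [hβy]; ring
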